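/- Let n be a fixed integer, let t be an integer with 0 ≤ t < n, and let p : ℕ → (0,1) satisfy both D^{t+1} · p(D) → ∞ and D^t · p(D) → 0 as D → ∞. Let 𝔍 = 𝔍(D) be the random monomial ideal of the ER-type model with parameter p(D). Then P(dim S/𝔍 = t) → 1 as D → ∞. -/

import Mathlib

open Finset MvPolynomial Filter

noncomputable section

/-- The set of exponent vectors of nonconstant monomials in `n` variables of total degree
at most `D`. -/
def monSet (n D : ℕ) : Finset (Fin n → ℕ) :=
  (Fintype.piFinset fun _ : Fin n => Finset.range (D + 1)).filter
    fun α => 0 < ∑ i, α i ∧ ∑ i, α i ≤ D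

/-- The monomial `x^α` of `MvPolynomial (Fin n) K` with exponent vector `α`. -/
def mono (K : Type*) [CommRing K] {n : ℕ} (α : Fin n → ℕ) : MvPolynomial (Fin n) K :=
  MvPolynomial.monomial (Finsupp.equivFunOnFinite.symm α) 1

/-- The monomial ideal generated by a set of exponent vectors. -/
def idealOf (K : Type*) [CommRing K] {n : ℕ} (B : Finset (Fin n → ℕ)) :
    Ideal (MvPolynomial (Fin n) K) :=
  Ideal.span (mono K '' (B : Set (Fin n → ℕ)))

open Classical in
/-- The probability, under the ER-type model `ℐ(n,D,p)`, of the event `E` on random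
generating sets `𝔅 ⊆ M(n,D)`. -/
def ERprob (n D : ℕ) (p : ℝ) (E : Set (Finset (Fin n → ℕ))) : ℝ :=
  ∑ B ∈ (monSet n D).powerset.filter (· ∈ E),
    p ^ B.card * (1 - p) ^ ((monSet n D).card - B.card)

/-- `I` is a monomial ideal. -/
def IsMonomialIdeal (K : Type*) [CommRing K] {n : ℕ}
    (I : Ideal (MvPolynomial (Fin n) K)) : Prop :=
  ∃ G : Set (Fin n → ℕ), I = Ideal.span (mono K '' G)

/-- `x^α` is a minimal monomial generator of `I`: it lies in `I` and no proper divisor does. -/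
def IsMinGen (K : Type*) [CommRing K] {n : ℕ} (I : Ideal (MvPolynomial (Fin n) K))
    (α : Fin n → ℕ) : Prop :=
  mono K α ∈ I ∧ ∀ β : Fin n → ℕ, (∀ i, β i ≤ α i) → β ≠ α → mono K β ∉ I

/-- `β₁(S/I)`: the number of minimal monomial generators of `I`. -/
def beta1 (K : Type*) [CommRing K] {n : ℕ} (I : Ideal (MvPolynomial (Fin n) K)) : ℕ :=
  {α : Fin n → ℕ | IsMinGen K I α}.ncard

/-- `β_{1,d}(S/I)`: the number of minimal monomial generators of `I` of degree `d`. -/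
def beta1d (K : Type*) [CommRing K] {n : ℕ} (I : Ideal (MvPolynomial (Fin n) K)) (d : ℕ) : ℕ :=
  {α : Fin n → ℕ | IsMinGen K I α ∧ ∑ i, α i = d}.ncard

/-- `h_I(d)`: the number of monomials of degree exactly `d` not contained in `I`. -/
def hilb (K : Type*) [CommRing K] {n : ℕ} (I : Ideal (MvPolynomial (Fin n) K)) (d : ℕ) : ℕ :=
  {α : Fin n → ℕ | ∑ i, α i = d ∧ mono K α ∉ I}.ncard

/-- The exponent vectors in `monSet n D` whose support is contained in `T`. -/
def suppIn (n D : ℕ) (T : Finset (Fin n)) : Finset (Fin n → ℕ) :=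
  (monSet n D).filter fun α => ∀ i ∉ T, α i = 0

lemma mem_suppIn {n D : ℕ} {T : Finset (Fin n)} {α : Fin n → ℕ} :
    α ∈ suppIn n D T ↔ α ∈ monSet n D ∧ ∀ i ∉ T, α i = 0 := by
  simp [suppIn]

lemma mem_monSet {n D : ℕ} {α : Fin n → ℕ} :
    α ∈ monSet n D ↔ 0 < ∑ i, α i ∧ ∑ i, α i ≤ D := by
  simp only [monSet, Finset.mem_filter, Fintype.mem_piFinset, Finset.mem_range,
    and_iff_right_iff_imp]
  intro h i
  have := Finset.single_le_sum (f := α) (fun j _ => Nat.zero_le _) (Finset.mem_univ i)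
  omega

lemma card_boxIn {n : ℕ} (m : ℕ) (T : Finset (Fin n)) :
    (Fintype.piFinset fun i : Fin n => if i ∈ T then Finset.range m else {0}).card
      = m ^ T.card := by
  rw [Fintype.card_piFinset]
  simp [apply_ite Finset.card, Finset.prod_ite_mem]

lemma card_suppIn_le (n D : ℕ) (T : Finset (Fin n)) :
    (suppIn n D T).card ≤ (D + 1) ^ T.card := by
  rw [← card_boxIn]
  apply Finset.card_le_card
  intro α hα
  rw [mem_suppIn, mem_monSet] at hα
  rw [Fintype.mem_piFinset]
  intro i
  have := Finset.single_le_sum (f := α) (fun j _ => Nat.zero_le _) (Finset.mem_univ i)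
  split_ifs with hi
  · rw [Finset.mem_range]
    omega
  · simpa using hα.2 i hi

lemma le_card_suppIn (n D : ℕ) (T : Finset (Fin n)) :
    (D / T.card + 1) ^ T.card ≤ (suppIn n D T).card + 1 := by
  rw [← card_boxIn]
  refine le_trans (Finset.card_le_card ?_) (Finset.card_insert_le 0 (suppIn n D T))
  intro α hα
  rw [Fintype.mem_piFinset] at hα
  have hout : ∀ i ∉ T, α i = 0 := fun i hi => by simpa [hi] using hα i
  have hin : ∀ i ∈ T, α i ≤ D / T.card := fun i hi => by
    have := hα i
    rw [if_pos hi, Finset.mem_range] at this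
    omega
  have hsum : ∑ i, α i ≤ D := by
    rw [← Finset.sum_subset (Finset.subset_univ T) (fun i _ hi => hout i hi)]
    exact (Finset.sum_le_card_nsmul T α _ hin).trans (Nat.mul_div_le D T.card)
  rw [Finset.mem_insert, mem_suppIn, mem_monSet]
  by_cases h0 : α = 0
  · exact Or.inl h0
  · refine Or.inr ⟨⟨?_, hsum⟩, hout⟩
    obtain ⟨i, hi⟩ := Function.ne_iff.mp h0
    exact Finset.sum_pos' (fun _ _ => Nat.zero_le _)
      ⟨i, Finset.mem_univ i, Nat.pos_of_ne_zero hi⟩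

/-! ### The probability model -/

lemma ERprob_le_one (n D : ℕ) {p : ℝ} (h0 : 0 ≤ p) (h1 : p ≤ 1)
    (E : Set (Finset (Fin n → ℕ))) : ERprob n D p E ≤ 1 := by
  classical
  have htotal := Finset.sum_pow_mul_eq_add_pow p (1 - p) (monSet n D)
  rw [add_sub_cancel, one_pow] at htotal
  rw [← htotal]
  have h2 : 0 ≤ 1 - p := sub_nonneg.mpr h1
  exact Finset.sum_le_sum_of_subset_of_nonneg (Finset.filter_subset _ _)
    fun _ _ _ => by positivity

lemma ERprob_le_add_sum {ι : Type*} (n D : ℕ) {p : ℝ} (h0 : 0 ≤ p) (h1 : p ≤ 1)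
    (E F : Set (Finset (Fin n → ℕ))) (s : Finset ι) (G : ι → Set (Finset (Fin n → ℕ)))
    (h : ∀ B ⊆ monSet n D, B ∈ F → B ∈ E ∨ ∃ i ∈ s, B ∈ G i) :
    ERprob n D p F ≤ ERprob n D p E + ∑ i ∈ s, ERprob n D p (G i) := by
  classical
  have h2 : 0 ≤ 1 - p := sub_nonneg.mpr h1
  simp only [ERprob, Finset.sum_filter]
  rw [Finset.sum_comm, ← Finset.sum_add_distrib]
  refine Finset.sum_le_sum fun B hB => ?_
  set w := p ^ B.card * (1 - p) ^ ((monSet n D).card - B.card)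
  have hw : 0 ≤ w := by positivity
  have hnn : ∀ i ∈ s, 0 ≤ if B ∈ G i then w else 0 := fun i _ => by split_ifs <;> simp [hw]
  have hE : 0 ≤ if B ∈ E then w else 0 := by split_ifs <;> simp [hw]
  by_cases hF : B ∈ F
  · rw [if_pos hF]
    rcases h B (Finset.mem_powerset.mp hB) hF with hBE | ⟨i, hi, hBi⟩
    · rw [if_pos hBE]
      linarith [Finset.sum_nonneg hnn]
    · have := Finset.single_le_sum hnn hi
      rw [if_pos hBi] at this
      linarith
  · rw [if_neg hF]
    exact add_nonneg hE (Finset.sum_nonneg hnn)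

lemma ERprob_disjoint (n D : ℕ) (p : ℝ) {A : Finset (Fin n → ℕ)} (hA : A ⊆ monSet n D) :
    ERprob n D p {B | Disjoint B A} = (1 - p) ^ A.card := by
  classical
  have hfilter : (monSet n D).powerset.filter (· ∈ {B | Disjoint B A})
      = (monSet n D \ A).powerset := by
    ext B
    simp [Finset.subset_sdiff]
  have hcard := Finset.card_sdiff_add_card_eq_card hA
  have htotal := Finset.sum_pow_mul_eq_add_pow p (1 - p) (monSet n D \ A)
  rw [add_sub_cancel, one_pow] at htotal
  calc ERprob n D p {B | Disjoint B A}
      = ∑ B ∈ (monSet n D \ A).powerset,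
          p ^ B.card * (1 - p) ^ ((monSet n D).card - B.card) := by
        rw [ERprob, ← hfilter]
        refine Finset.sum_congr ?_ fun _ _ => rfl
        ext B
        simp
    _ = ∑ B ∈ (monSet n D \ A).powerset,
          p ^ B.card * (1 - p) ^ ((monSet n D \ A).card - B.card) * (1 - p) ^ A.card := by
        refine Finset.sum_congr rfl fun B hB => ?_
        have := Finset.card_le_card (Finset.mem_powerset.mp hB)
        rw [mul_assoc, ← pow_add]
        congr 2
        omega
    _ = (1 - p) ^ A.card := by rw [← Finset.sum_mul, htotal, one_mul]

/-! ### Krull dimension of monomial quotients -/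

section Dimension

variable {K : Type*} [Field K] {n : ℕ}

lemma mono_eq_prod (α : Fin n → ℕ) : mono K α = ∏ i, (X i : MvPolynomial (Fin n) K) ^ α i := by
  rw [mono, MvPolynomial.monomial_eq, map_one, one_mul, Finsupp.prod_fintype _ _ (by simp)]
  rfl

lemma ringKrullDim_mvPolynomial_subtype (T : Finset (Fin n)) :
    ringKrullDim (MvPolynomial T K) = (T.card : WithBot ℕ∞) := by
  rw [MvPolynomial.ringKrullDim_of_isNoetherianRing, ringKrullDim_eq_zero_of_field, zero_add]
  simp

lemma card_le_ringKrullDim_quotient_idealOf (B : Finset (Fin n → ℕ)) (T : Finset (Fin n))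
    (h : ∀ α ∈ B, ∃ i ∉ T, α i ≠ 0) :
    (T.card : WithBot ℕ∞) ≤ ringKrullDim (MvPolynomial (Fin n) K ⧸ idealOf K B) := by
  classical
  let φ : MvPolynomial (Fin n) K →ₐ[K] MvPolynomial T K :=
    aeval fun i => if hi : i ∈ T then X ⟨i, hi⟩ else 0
  have hker : ∀ a ∈ idealOf K B, (φ : MvPolynomial (Fin n) K →+* MvPolynomial T K) a = 0 := by
    intro a ha
    suffices hle : idealOf K B ≤ RingHom.ker φ from hle ha
    refine Ideal.span_le.mpr ?_
    rintro _ ⟨α, hα, rfl⟩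
    obtain ⟨i, hiT, hi⟩ := h α hα
    change φ (mono K α) = 0
    rw [mono_eq_prod, map_prod]
    exact Finset.prod_eq_zero (Finset.mem_univ i) (by simp [φ, hiT, hi])
  have hsurj : Function.Surjective φ := by
    rw [← AlgHom.range_eq_top, eq_top_iff, ← MvPolynomial.adjoin_range_X, Algebra.adjoin_le_iff]
    rintro _ ⟨i, rfl⟩
    exact ⟨X i, by simp [φ]⟩
  rw [← ringKrullDim_mvPolynomial_subtype (K := K)]
  exact ringKrullDim_le_of_surjective (Ideal.Quotient.lift _ _ hker)
    (Ideal.Quotient.lift_surjective_of_surjective _ hker hsurj)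

lemma ringKrullDim_quotient_span_X_le (T : Finset (Fin n)) :
    ringKrullDim (MvPolynomial (Fin n) K ⧸
      Ideal.span ((X : Fin n → MvPolynomial (Fin n) K) '' {i | i ∉ T}))
      ≤ (T.card : WithBot ℕ∞) := by
  set J := Ideal.span ((X : Fin n → MvPolynomial (Fin n) K) '' {i | i ∉ T})
  let ψ : MvPolynomial T K →ₐ[K] MvPolynomial (Fin n) K ⧸ J :=
    (Ideal.Quotient.mkₐ K J).comp (rename Subtype.val)
  have hsurj : Function.Surjective ψ := by
    have hrange : (Ideal.Quotient.mkₐ K J).range ≤ ψ.range := by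
      rw [← Algebra.map_top, ← MvPolynomial.adjoin_range_X, AlgHom.map_adjoin,
        Algebra.adjoin_le_iff]
      rintro _ ⟨_, ⟨i, rfl⟩, rfl⟩
      by_cases hi : i ∈ T
      · exact ⟨X ⟨i, hi⟩, by simp [ψ]⟩
      · refine ⟨0, ?_⟩
        rw [map_zero]
        exact (Ideal.Quotient.eq_zero_iff_mem.mpr
          (Ideal.subset_span (Set.mem_image_of_mem _ hi))).symm
    intro y
    obtain ⟨x, rfl⟩ := Ideal.Quotient.mkₐ_surjective K J y
    exact hrange ⟨x, rfl⟩
  rw [← ringKrullDim_mvPolynomial_subtype (K := K)]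
  exact ringKrullDim_le_of_surjective ψ.toRingHom hsurj

lemma ringKrullDim_quotient_idealOf_le (B : Finset (Fin n → ℕ)) (t : ℕ)
    (h : ∀ T : Finset (Fin n), T.card = t + 1 → ∃ α ∈ B, ∀ i ∉ T, α i = 0) :
    ringKrullDim (MvPolynomial (Fin n) K ⧸ idealOf K B) ≤ (t : WithBot ℕ∞) := by
  classical
  rw [ringKrullDim_quotient]
  refine iSup_le fun l => ?_
  let P : Ideal (MvPolynomial (Fin n) K) := l.head.1.asIdeal
  have hP : P.IsPrime := l.head.1.isPrime
  let T : Finset (Fin n) := Finset.univ.filter fun i => X i ∉ P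
  have hT : T.card ≤ t := by
    by_contra! hlt
    obtain ⟨T', hT'T, hT'⟩ := Finset.exists_subset_card_eq (Nat.succ_le_of_lt hlt)
    obtain ⟨α, hαB, hα⟩ := h T' hT'
    have hmem : mono K α ∈ P := l.head.2 (Ideal.subset_span ⟨α, hαB, rfl⟩)
    rw [mono_eq_prod] at hmem
    obtain ⟨i, -, hi⟩ := hP.prod_mem_iff.mp hmem
    have hXi : (X i : MvPolynomial (Fin n) K) ∈ P := hP.mem_of_pow_mem _ hi
    have hiT' : i ∉ T' := fun hi' => (Finset.mem_filter.mp (hT'T hi')).2 hXi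
    rw [hα i hiT', pow_zero] at hi
    exact hP.ne_top ((Ideal.eq_top_iff_one _).mpr hi)
  have hJP : Ideal.span ((X : Fin n → MvPolynomial (Fin n) K) '' {i | i ∉ T}) ≤ P := by
    rw [Ideal.span_le]
    rintro _ ⟨i, hi, rfl⟩
    simpa [T] using hi
  refine le_trans ?_ ((ringKrullDim_quotient_span_X_le (K := K) T).trans (by exact_mod_cast hT))
  rw [ringKrullDim_quotient]
  let l' : LTSeries (PrimeSpectrum.zeroLocus
      (Ideal.span ((X : Fin n → MvPolynomial (Fin n) K) '' {i | i ∉ T}) : Set _)) :=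
    { length := l.length
      toFun := fun j => ⟨(l j).1, fun _ hx => LTSeries.head_le l j (hJP hx)⟩
      step := fun j => l.step j }
  exact Order.LTSeries.length_le_krullDim l'

end Dimension

lemma ERprob_dim_ge (K : Type*) [Field K] (n t D : ℕ) (T₀ : Finset (Fin n))
    (hT₀ : T₀.card = t) {p : ℝ} (h0 : 0 ≤ p) (h1 : p ≤ 1) :
    (1 - p) ^ (suppIn n D T₀).card ≤
      ERprob n D p {B | ringKrullDim (MvPolynomial (Fin n) K ⧸ idealOf K B)
          = (t : WithBot (WithTop ℕ))}
      + ∑ T ∈ Finset.powersetCard (t + 1) Finset.univ, (1 - p) ^ (suppIn n D T).card := by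
  have hsub : ∀ T, suppIn n D T ⊆ monSet n D := fun T => Finset.filter_subset _ _
  simp_rw [← ERprob_disjoint n D p (hsub _)]
  refine ERprob_le_add_sum n D h0 h1 _ _ _ _ fun B hB hdisj => ?_
  by_cases hG : ∃ T ∈ Finset.powersetCard (t + 1) Finset.univ, B ∈ {B | Disjoint B (suppIn n D T)}
  · exact Or.inr hG
  left
  push Not at hG
  refine le_antisymm (ringKrullDim_quotient_idealOf_le B t fun T hT => ?_) ?_
  · obtain ⟨α, hαB, hα⟩ := Finset.not_disjoint_iff.mp
      (hG T (Finset.mem_powersetCard.mpr ⟨Finset.subset_univ _, hT⟩))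
    exact ⟨α, hαB, (mem_suppIn.mp hα).2⟩
  · refine le_trans (by rw [hT₀]; rfl) (card_le_ringKrullDim_quotient_idealOf B T₀ fun α hα => ?_)
    by_contra! hcon
    exact Finset.disjoint_left.mp hdisj hα (mem_suppIn.mpr ⟨hB hα, hcon⟩)

lemma one_sub_le_pow_suppIn (n t D : ℕ) (T : Finset (Fin n)) (hT : T.card = t)
    {p : ℝ} (h0 : 0 ≤ p) (h1 : p ≤ 1) :
    1 - ((D : ℝ) + 1) ^ t * p ≤ (1 - p) ^ (suppIn n D T).card := by
  have hbern := one_add_mul_le_pow (a := -p) (by linarith) (suppIn n D T).card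
  have hcard : ((suppIn n D T).card : ℝ) ≤ ((D : ℝ) + 1) ^ t := by
    rw [← hT]
    exact_mod_cast card_suppIn_le n D T
  rw [← sub_eq_add_neg] at hbern
  nlinarith [mul_le_mul_of_nonneg_right hcard h0]

lemma pow_suppIn_le_exp (n t D : ℕ) (T : Finset (Fin n)) (hT : T.card = t + 1)
    {p : ℝ} (h0 : 0 ≤ p) (h1 : p ≤ 1) :
    (1 - p) ^ (suppIn n D T).card
      ≤ Real.exp (1 - ((D : ℝ) ^ (t + 1) * p) / ((t : ℝ) + 1) ^ (t + 1)) := by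
  have hcard : ((D : ℝ) / ((t : ℝ) + 1)) ^ (t + 1) ≤ (suppIn n D T).card + 1 := by
    have hfloor : (D : ℝ) / ((t : ℝ) + 1) ≤ ((D / (t + 1) : ℕ) : ℝ) + 1 := by
      rw [div_le_iff₀ (by positivity)]
      exact_mod_cast (Nat.lt_mul_of_div_lt (Nat.lt_add_one (D / (t + 1))) t.succ_pos).le
    have hle := le_card_suppIn n D T
    rw [hT] at hle
    calc ((D : ℝ) / ((t : ℝ) + 1)) ^ (t + 1) ≤ (((D / (t + 1) : ℕ) : ℝ) + 1) ^ (t + 1) := by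
          gcongr
      _ ≤ _ := by exact_mod_cast hle
  calc (1 - p) ^ (suppIn n D T).card ≤ Real.exp (-p) ^ (suppIn n D T).card := by
        refine pow_le_pow_left₀ (by linarith) ?_ _
        linarith [Real.add_one_le_exp (-p)]
    _ = Real.exp ((suppIn n D T).card * -p) := by rw [← Real.exp_nat_mul]
    _ ≤ _ := by
        apply Real.exp_le_exp.mpr
        have := mul_le_mul_of_nonneg_right hcard h0
        rw [div_pow, div_mul_eq_mul_div] at this
        linarith

lemma tendsto_succ_pow_mul (t : ℕ) {p : ℕ → ℝ} (hp : ∀ D, 0 ≤ p D)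
    (h : Filter.Tendsto (fun D : ℕ => (D : ℝ) ^ t * p D) Filter.atTop (nhds 0)) :
    Filter.Tendsto (fun D : ℕ => ((D : ℝ) + 1) ^ t * p D) Filter.atTop (nhds 0) := by
  have h2 := h.const_mul ((2 : ℝ) ^ t)
  rw [mul_zero] at h2
  refine tendsto_of_tendsto_of_tendsto_of_le_of_le' tendsto_const_nhds h2
    (Eventually.of_forall fun D => mul_nonneg (by positivity) (hp D)) ?_
  filter_upwards [eventually_ge_atTop 1] with D hD
  have hD' : (1 : ℝ) ≤ D := by exact_mod_cast hD
  rw [← mul_assoc, ← mul_pow]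
  exact mul_le_mul_of_nonneg_right (pow_le_pow_left₀ (by positivity) (by linarith) t) (hp D)

/-- Corollary 1.2. For fixed `n` and `0 ≤ t < n`, if
`p(D) = ω(D^{-(t+1)})` and `p(D) = o(D^{-t})`, then `dim S/𝔍 = t` asymptotically almost
surely as `D → ∞`. -/
theorem stmt9 (K : Type*) [Field K] (n t : ℕ) (hn : 1 ≤ n) (ht : t < n)
    (p : ℕ → ℝ) (hp : ∀ D, 0 < p D ∧ p D < 1)
    (homega : Filter.Tendsto (fun D : ℕ => (D : ℝ) ^ (t + 1) * p D) Filter.atTop Filter.atTop)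
    (hlittleo : Filter.Tendsto (fun D : ℕ => (D : ℝ) ^ t * p D) Filter.atTop (nhds 0)) :
    Filter.Tendsto (fun D : ℕ => ERprob n D (p D)
        {B | ringKrullDim (MvPolynomial (Fin n) K ⧸ idealOf K B)
          = (t : WithBot (WithTop ℕ))})
      Filter.atTop (nhds 1) := by
  obtain ⟨T₀, -, hT₀⟩ := Finset.exists_subset_card_eq
    (show t ≤ (Finset.univ : Finset (Fin n)).card by simpa using ht.le)
  have hlow := tendsto_succ_pow_mul t (fun D => (hp D).1.le) hlittleo
  have hexp : Filter.Tendsto (fun D : ℕ =>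
      Real.exp (1 - ((D : ℝ) ^ (t + 1) * p D) / ((t : ℝ) + 1) ^ (t + 1)))
      Filter.atTop (nhds 0) := by
    apply Real.tendsto_exp_atBot.comp
    exact tendsto_atBot_add_const_left _ 1
      (tendsto_neg_atTop_atBot.comp (homega.atTop_div_const (by positivity)))
  have hbound := (hlow.const_sub 1).sub (hexp.const_mul
    ((Finset.powersetCard (t + 1) (Finset.univ : Finset (Fin n))).card : ℝ))
  rw [mul_zero, sub_zero, sub_zero] at hbound
  refine tendsto_of_tendsto_of_tendsto_of_le_of_le hbound tendsto_const_nhds (fun D => ?_)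
    fun D => ERprob_le_one n D (hp D).1.le (hp D).2.le _
  have hge := ERprob_dim_ge K n t D T₀ hT₀ (hp D).1.le (hp D).2.le
  have hone := one_sub_le_pow_suppIn n t D T₀ hT₀ (hp D).1.le (hp D).2.le
  have hsum := Finset.sum_le_card_nsmul (Finset.powersetCard (t + 1) Finset.univ)
    (fun T => (1 - p D) ^ (suppIn n D T).card) _ fun T hT =>
      pow_suppIn_le_exp n t D T (Finset.mem_powersetCard.mp hT).2 (hp D).1.le (hp D).2.le
  rw [nsmul_eq_mul] at hsum
  linarith

end
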